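/- Let p be a depth-zero, bifix-free pattern of dimensions a×c with a ≥ 2 and c ≥ 1. Then for every n ≥ 0, the number of Dyck paths of semilength n avoiding p satisfies, in ℚ: s_p(n, n) = Σ_{i ≥ 0, a·i ≤ n} (−1)^i · (1/(n − c·i + 1)) · C(n − (a−1)i, i) · C(2n − (a+c−1)i, n − (a−1)i). -/

import Mathlib

/-- A step of a lattice path: `u` (up) or `r` (right). -/
inductive Step : Type
  | u : Step
  | r : Step
deriving DecidableEq

/-- A word over the alphabet `{u, r}`. -/
abbrev Word := List Step

/-- The number of letters `r` in a word. -/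
def countR (w : Word) : ℕ := w.count Step.r

/-- The number of letters `u` in a word. -/
def countU (w : Word) : ℕ := w.count Step.u

/-- `dval q` = (number of `r`'s in `q`) - (number of `u`'s in `q`). -/
def dval (w : Word) : ℤ := (countR w : ℤ) - (countU w : ℤ)

/-- A pattern is depth-zero if every suffix `q` of it satisfies `dval q ≥ 0`. -/
def DepthZero (p : Word) : Prop := ∀ q : Word, q <:+ p → 0 ≤ dval q

/-- `o` is a bifix of `p`: a nonempty proper prefix of `p` that is also a (proper) suffix. -/
def IsBifix (o p : Word) : Prop := o ≠ [] ∧ o ≠ p ∧ o <+: p ∧ o <:+ p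

/-- A pattern is bifix-free if it has no bifix. -/
def BifixFree (p : Word) : Prop := ∀ o : Word, ¬ IsBifix o p

/-- `w` is a ballot path to the lattice point `(n, m)`: it has exactly `n` letters `r`
and `m` letters `u`, and every prefix has at least as many `u`'s as `r`'s. -/
def IsBallot (w : Word) (n m : ℤ) : Prop :=
  (countR w : ℤ) = n ∧ (countU w : ℤ) = m ∧
    ∀ t : Word, t <+: w → countR t ≤ countU t

/-- `w` avoids the pattern `p`: `p` does not occur in `w` as a contiguous substring. -/
def Avoids (p w : Word) : Prop := ¬ p <:+: w

/-- `s p n m` is the number of ballot paths to `(n, m)` avoiding `p`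
(`0` if `n < 0`, `m < 0`, or `m < n`, since then no such path exists). -/
noncomputable def s (p : Word) (n m : ℤ) : ℕ :=
  Set.ncard {w : Word | IsBallot w n m ∧ Avoids p w}

/-- If `w` avoids a bifix-free `p`, then every proper prefix of `w ++ p` avoids `p`:
the only occurrence of `p` in `w ++ p` is the final one. -/
lemma Avoids.of_append_eq {p w v e : Word} (hbf : BifixFree p) (hw : Avoids p w)
    (he : e ≠ []) (h : w ++ p = v ++ e) : Avoids p v := by
  rintro ⟨x, t, rfl⟩
  have h' : w ++ p = x ++ p ++ (t ++ e) := by simpa using h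
  have ht : t ++ e ≠ [] := by simp [he]
  generalize t ++ e = t' at h' ht
  rcases List.append_eq_append_iff.1 h' with ⟨o, ho, hp⟩ | ⟨o, ho, -⟩
  · by_cases hne : o = []
    · subst hne
      exact hw ⟨x, [], by simpa [eq_comm] using ho⟩
    · refine hbf o ⟨hne, ?_, ⟨t', hp.symm⟩, ?_⟩
      · rintro rfl
        exact ht (List.append_right_eq_self.1 hp.symm)
      · refine List.suffix_of_suffix_length_le (l₃ := x ++ p) ⟨w, ho.symm⟩ ⟨x, rfl⟩ ?_
        rw [hp]
        simp
  · exact hw ⟨x, o, ho.symm⟩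

lemma Avoids.mono {p v w : Word} (hw : Avoids p w) (h : v <:+: w) : Avoids p v :=
  fun hv => hw (hv.trans h)

lemma countR_append (v w : Word) : countR (v ++ w) = countR v + countR w := by
  simp [countR]

lemma countU_append (v w : Word) : countU (v ++ w) = countU v + countU w := by
  simp [countU]

lemma IsBallot.le {w : Word} {n m : ℤ} (h : IsBallot w n m) : n ≤ m := by
  have := h.2.2 w List.prefix_rfl
  have := h.1
  have := h.2.1
  omega

lemma IsBallot.of_append {v e : Word} {n m : ℤ} (h : IsBallot (v ++ e) n m) :
    IsBallot v (n - countR e) (m - countU e) := by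
  obtain ⟨h1, h2, h3⟩ := h
  rw [countR_append] at h1
  rw [countU_append] at h2
  refine ⟨by omega, by omega, fun t ht => h3 t (ht.trans (List.prefix_append v e))⟩

/-- Appending a depth-zero word to a ballot path gives a ballot path as soon as the endpoint
is weakly above the diagonal. -/
lemma IsBallot.append {v e : Word} {n m : ℤ} (he : DepthZero e)
    (h : IsBallot v (n - countR e) (m - countU e)) (hnm : n ≤ m) :
    IsBallot (v ++ e) n m := by
  obtain ⟨h1, h2, h3⟩ := h
  refine ⟨by rw [countR_append]; omega, by rw [countU_append]; omega, fun t ht => ?_⟩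
  rcases List.prefix_or_prefix_of_prefix ht (List.prefix_append v e) with h | ⟨q, rfl⟩
  · exact h3 t h
  · obtain ⟨q', rfl⟩ := (List.prefix_append_right_inj v).1 ht
    have := he q' (List.suffix_append q q')
    simp only [dval, countR_append, countU_append] at *
    omega

lemma IsBallot.append_singleton {v : Word} {x : Step} {n m : ℤ}
    (h : IsBallot v (n - countR [x]) (m - countU [x])) (hnm : n ≤ m) :
    IsBallot (v ++ [x]) n m := by
  obtain ⟨h1, h2, h3⟩ := h
  refine ⟨by rw [countR_append]; omega, by rw [countU_append]; omega, fun t ht => ?_⟩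
  rcases List.prefix_concat_iff.1 ht with rfl | h
  · rw [countR_append, countU_append]
    omega
  · exact h3 t h

/-- The ballot paths to `(n, m)` avoiding `p`. -/
def avoidingBallots (p : Word) (n m : ℤ) : Set Word := {w | IsBallot w n m ∧ Avoids p w}

instance : Finite Step :=
  Finite.of_injective (fun x : Step => decide (x = Step.u)) (by
    intro x y h
    cases x <;> cases y <;> simp_all)

lemma length_eq_countR_add_countU (w : Word) : w.length = countR w + countU w := by
  induction w with
  | nil => rfl
  | cons x w ih => cases x <;> simp_all [countR, countU] <;> omega

lemma finite_avoidingBallots (p : Word) (n m : ℤ) : (avoidingBallots p n m).Finite := by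
  refine (List.finite_length_eq Step (n + m).toNat).subset ?_
  rintro w ⟨⟨h1, h2, -⟩, -⟩
  have := length_eq_countR_add_countU w
  simp only [Set.mem_ofPred_eq]
  omega

/-- Extending the avoiding paths by one letter produces either an avoiding path or an avoiding
path followed by one copy of `p`. -/
lemma avoidingBallots_union {p : Word} (hdz : DepthZero p) (hbf : BifixFree p) (hp : p ≠ [])
    {n m : ℤ} (hnm : n ≤ m) (h0 : 0 < n + m) :
    avoidingBallots p n m ∪ (· ++ p) '' avoidingBallots p (n - countR p) (m - countU p) =
      (· ++ [Step.r]) '' avoidingBallots p (n - 1) m ∪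
        (· ++ [Step.u]) '' avoidingBallots p n (m - 1) := by
  have key : ∀ w : Word, w ∈ (· ++ [Step.r]) '' avoidingBallots p (n - 1) m ∪
        (· ++ [Step.u]) '' avoidingBallots p n (m - 1) ↔
      ∃ v x, w = v ++ [x] ∧ v ∈ avoidingBallots p (n - countR [x]) (m - countU [x]) := by
    intro w
    constructor
    · rintro (⟨v, hv, rfl⟩ | ⟨v, hv, rfl⟩)
      · exact ⟨v, Step.r, rfl, by simpa [countR, countU] using hv⟩
      · exact ⟨v, Step.u, rfl, by simpa [countR, countU] using hv⟩
    · rintro ⟨v, x, rfl, hv⟩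
      cases x
      · exact Or.inr ⟨v, by simpa [countR, countU] using hv, rfl⟩
      · exact Or.inl ⟨v, by simpa [countR, countU] using hv, rfl⟩
  ext w
  rw [key]
  constructor
  · rintro (⟨hb, hav⟩ | ⟨v, ⟨hb, hav⟩, rfl⟩)
    · rcases List.eq_nil_or_concat w with rfl | ⟨v, x, rfl⟩
      · have h1 := hb.1
        have h2 := hb.2.1
        simp [countR, countU] at h1 h2
        omega
      · rw [List.concat_eq_append] at *
        exact ⟨v, x, rfl, hb.of_append, hav.mono (List.prefix_append v [x]).isInfix⟩
    · have hb' := hb.append hdz hnm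
      rcases List.eq_nil_or_concat (v ++ p) with h | ⟨v', x, h⟩
      · simp_all
      · rw [List.concat_eq_append] at h
        exact ⟨v', x, h, (h ▸ hb').of_append, hav.of_append_eq hbf (by simp) h⟩
  · rintro ⟨v, x, rfl, hb, hav⟩
    have hb' := hb.append_singleton hnm
    by_cases h : Avoids p (v ++ [x])
    · exact Or.inl ⟨hb', h⟩
    · obtain ⟨y, t, hyt⟩ := not_not.1 h
      rcases List.eq_nil_or_concat t with rfl | ⟨t, z, rfl⟩
      · rw [List.append_nil] at hyt
        refine Or.inr ⟨y, ⟨(hyt ▸ hb').of_append, ?_⟩, hyt⟩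
        refine hav.mono (List.prefix_of_prefix_length_le (l₃ := v ++ [x])
          ⟨p, hyt⟩ (List.prefix_append v [x]) ?_).isInfix
        have := congrArg List.length hyt
        have := List.length_pos_iff.2 hp
        simp at *
        omega
      · rw [List.concat_eq_append, ← List.append_assoc] at hyt
        exact absurd ⟨y, t, (List.append_inj' hyt rfl).1⟩ hav

lemma s_recurrence {p : Word} (hdz : DepthZero p) (hbf : BifixFree p) (hp : p ≠ [])
    {n m : ℤ} (hnm : n ≤ m) (h0 : 0 < n + m) :
    s p n m + s p (n - countR p) (m - countU p) = s p (n - 1) m + s p n (m - 1) := by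
  have h := congrArg Set.ncard (avoidingBallots_union hdz hbf hp hnm h0)
  rw [Set.ncard_union_eq _ (finite_avoidingBallots ..) ((finite_avoidingBallots ..).image _),
    Set.ncard_union_eq _ ((finite_avoidingBallots ..).image _)
      ((finite_avoidingBallots ..).image _),
    Set.ncard_image_of_injective _ (List.append_left_injective _),
    Set.ncard_image_of_injective _ (List.append_left_injective _),
    Set.ncard_image_of_injective _ (List.append_left_injective _)] at h
  · exact h
  · rw [Set.disjoint_left]
    rintro _ ⟨v, -, rfl⟩ ⟨v', -, h⟩
    simpa using (List.append_inj' h rfl).2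
  · rw [Set.disjoint_left]
    rintro _ ⟨-, hav⟩ ⟨v, -, rfl⟩
    exact hav (List.suffix_append v p).isInfix

lemma s_eq_zero_of_neg (p : Word) {n : ℤ} (m : ℤ) (hn : n < 0) : s p n m = 0 := by
  have : avoidingBallots p n m = ∅ :=
    Set.eq_empty_of_forall_notMem fun w hw => by
      have := hw.1.1
      omega
  exact (congrArg Set.ncard this).trans (Set.ncard_empty _)

lemma s_eq_zero_of_lt (p : Word) {n m : ℤ} (h : m < n) : s p n m = 0 := by
  have : avoidingBallots p n m = ∅ :=
    Set.eq_empty_of_forall_notMem fun w hw => by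
      have := hw.1.le
      omega
  exact (congrArg Set.ncard this).trans (Set.ncard_empty _)

lemma s_zero_zero {p : Word} (hp : p ≠ []) : s p 0 0 = 1 := by
  have : avoidingBallots p 0 0 = {[]} := by
    ext w
    constructor
    · rintro ⟨⟨h1, h2, -⟩, -⟩
      have := length_eq_countR_add_countU w
      exact List.eq_nil_of_length_eq_zero (by omega)
    · rintro rfl
      exact ⟨⟨rfl, rfl, by simp [countR]⟩, by simpa [Avoids] using hp⟩
  exact (congrArg Set.ncard this).trans (Set.ncard_singleton _)

/-- The `i`-th summand of the closed form for `s p n m`, for a pattern of dimensions `a × c`. -/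
def avoidingTerm (a c n m i : ℕ) : ℚ :=
  if a * i ≤ n then
    (-1 : ℚ) ^ i * (((m : ℚ) - n + 1) / ((m : ℚ) - c * i + 1)) *
      (Nat.choose (n - (a - 1) * i) i : ℚ) *
      (Nat.choose (m + n - (a + c - 1) * i) (n - (a - 1) * i) : ℚ)
  else 0

lemma avoidingTerm_eq (b c k i y : ℕ) :
    avoidingTerm (b + 1) c (k + b * i) (y + c * i) i =
      (-1 : ℚ) ^ i * ((((y + c * i : ℕ) : ℚ) - ((k + b * i : ℕ) : ℚ) + 1) / ((y : ℚ) + 1)) *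
        (Nat.choose k i : ℚ) * (Nat.choose (y + k) k : ℚ) := by
  unfold avoidingTerm
  have h1 : k + b * i - (b + 1 - 1) * i = k := by simp
  have h2 : y + c * i + (k + b * i) - (b + 1 + c - 1) * i = y + k := by
    rw [Nat.sub_eq_iff_eq_add] <;> · rw [show b + 1 + c - 1 = b + c by omega]; nlinarith
  rw [h1, h2]
  split_ifs with h
  · push_cast
    ring
  · have : k < i := by
      by_contra hk
      exact h (by nlinarith)
    simp [Nat.choose_eq_zero_of_lt this]

lemma avoidingTerm_eq_zero {a c n m i : ℕ} (h : n < a * i) : avoidingTerm a c n m i = 0 :=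
  if_neg (by omega)

/-- The summand one step below height `m + 1 = y + c * i`. -/
lemma avoidingTerm_pred {b c k i y n m : ℕ} (hn : n = k + b * i) (hm : m + 1 = y + c * i)
    (hnm : n ≤ m) (hc : c * i ≤ n + 1) :
    avoidingTerm (b + 1) c (n + 1) m i =
      (-1 : ℚ) ^ i * ((m : ℚ) - n) * (Nat.choose (k + 1) i : ℚ) *
        ((Nat.choose (y + k) k : ℚ) / (k + 1)) := by
  rcases hnm.eq_or_lt with rfl | hlt
  · unfold avoidingTerm
    simp
  · obtain ⟨z, rfl⟩ : ∃ z, y = z + 1 := ⟨y - 1, by omega⟩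
    have hm' : m = z + c * i := by omega
    have hn' : n + 1 = (k + 1) + b * i := by omega
    have h := Nat.add_one_mul_choose_eq (z + k) k
    have hsym : (z + 1 + k).choose k * (z + 1) = (z + k + 1) * (z + k).choose k := by
      have h1 := Nat.choose_succ_right_eq (z + 1 + k) k
      have h2 : z + 1 + k - k = z + 1 := by omega
      rw [h2] at h1
      rw [← h1, show z + 1 + k = z + k + 1 by omega, h]
    have hX : (z + (k + 1)).choose (k + 1) * (k + 1) = (z + 1 + k).choose k * (z + 1) := by
      rw [hsym, ← add_assoc, h]
    have hX' : ((z + (k + 1)).choose (k + 1) : ℚ) * (k + 1) =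
        (z + 1 + k).choose k * (z + 1) := by exact_mod_cast hX
    have hq : ((z + (k + 1)).choose (k + 1) : ℚ) / (z + 1) =
        (z + 1 + k).choose k / (k + 1) := by
      rw [div_eq_div_iff (by positivity) (by positivity), hX']
    rw [hn', hm', avoidingTerm_eq, ← hq, ← hm', ← hn']
    push_cast
    ring

lemma choose_add_succ_cast (y k : ℕ) :
    ((y + (k + 1)).choose (k + 1) : ℚ) = (y + k + 1) * (y + k).choose k / (k + 1) := by
  rw [eq_div_iff (by positivity)]
  exact_mod_cast (Nat.add_one_mul_choose_eq (y + k) k).symm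

lemma avoidingTerm_zero_recurrence (b c : ℕ) {n m : ℕ} (hnm : n ≤ m) :
    avoidingTerm (b + 1) c (n + 1) (m + 1) 0 =
      avoidingTerm (b + 1) c (n + 1) m 0 + avoidingTerm (b + 1) c n (m + 1) 0 := by
  have h1 := avoidingTerm_eq b c (n + 1) 0 (m + 1)
  have h2 := avoidingTerm_eq b c n 0 (m + 1)
  have h3 := avoidingTerm_pred (b := b) (c := c) (k := n) (i := 0) (y := m + 1) (n := n) (m := m)
    (by simp) (by simp) hnm (by simp)
  simp only [mul_zero, add_zero] at h1 h2
  rw [h1, h2, h3, choose_add_succ_cast]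
  push_cast
  simp only [Nat.choose_zero_right]
  field_simp
  ring

lemma avoidingTerm_succ_recurrence {b c : ℕ} (hcb : c ≤ b + 1) {n m : ℕ} (hnm : n ≤ m) (i : ℕ) :
    avoidingTerm (b + 1) c (n + 1) (m + 1) (i + 1) +
        (if b + 1 ≤ n + 1 then avoidingTerm (b + 1) c (n - b) (m + 1 - c) i else 0) =
      avoidingTerm (b + 1) c (n + 1) m (i + 1) + avoidingTerm (b + 1) c n (m + 1) (i + 1) := by
  by_cases h : (b + 1) * (i + 1) ≤ n + 1
  · have hci : c * (i + 1) ≤ n + 1 := (Nat.mul_le_mul_right _ hcb).trans h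
    obtain ⟨k, hk⟩ : ∃ k, n = k + b * (i + 1) := ⟨n - b * (i + 1), by
      have : b * (i + 1) + (i + 1) ≤ n + 1 := by linarith
      omega⟩
    obtain ⟨y, hy⟩ : ∃ y, m + 1 = y + c * (i + 1) := ⟨m + 1 - c * (i + 1), by omega⟩
    have hb : b + 1 ≤ n + 1 := le_trans (Nat.le_mul_of_pos_right _ (Nat.succ_pos i)) h
    have h1 := avoidingTerm_eq b c (k + 1) (i + 1) y
    have h2 := avoidingTerm_eq b c k (i + 1) y
    have h4 := avoidingTerm_eq b c k i y
    rw [show k + 1 + b * (i + 1) = n + 1 by omega, ← hy] at h1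
    rw [← hk, ← hy] at h2
    rw [if_pos hb, show n - b = k + b * i by rw [hk, mul_add]; omega,
      show m + 1 - c = y + c * i by rw [hy, mul_add]; omega, h1, h2, h4,
      avoidingTerm_pred hk hy hnm hci, choose_add_succ_cast]
    have hQ : ((k : ℚ) + 1) * k.choose i = (k + 1).choose (i + 1) * (i + 1) := by
      exact_mod_cast Nat.add_one_mul_choose_eq k i
    have hP : ((k + 1).choose (i + 1) : ℚ) = k.choose i + k.choose (i + 1) := by
      exact_mod_cast Nat.choose_succ_succ k i
    have hkQ : (n : ℚ) = k + b * (i + 1) := by exact_mod_cast hk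
    have hyQ : (m : ℚ) = y + c * (i + 1) - 1 := by
      rw [eq_sub_iff_add_eq]
      exact_mod_cast hy
    have hR : (k.choose (i + 1) : ℚ) = (k + 1).choose (i + 1) - k.choose i := by linarith
    have hQ' : (k.choose i : ℚ) = (k + 1).choose (i + 1) * (i + 1) / (k + 1) := by
      rw [eq_div_iff (by positivity)]
      linarith
    rw [hR, hQ']
    push_cast
    rw [hkQ, hyQ]
    field_simp
    ring
  · have h1 : n + 1 < (b + 1) * (i + 1) := by omega
    have h2 : n < (b + 1) * (i + 1) := by omega
    have h3 : b + 1 ≤ n + 1 → n - b < (b + 1) * i := fun hb => by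
      rw [mul_add] at h1
      omega
    split_ifs with hb
    · simp only [avoidingTerm_eq_zero h1, avoidingTerm_eq_zero h2, avoidingTerm_eq_zero (h3 hb)]
    · simp only [avoidingTerm_eq_zero h1, avoidingTerm_eq_zero h2]

lemma sum_avoidingTerm_recurrence {b c : ℕ} (hcb : c ≤ b + 1) {n m : ℕ} (hnm : n ≤ m) (N : ℕ) :
    ∑ i ∈ Finset.range (N + 1), avoidingTerm (b + 1) c (n + 1) (m + 1) i +
        (if b + 1 ≤ n + 1 then
          ∑ i ∈ Finset.range N, avoidingTerm (b + 1) c (n - b) (m + 1 - c) i else 0) =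
      ∑ i ∈ Finset.range (N + 1), avoidingTerm (b + 1) c (n + 1) m i +
        ∑ i ∈ Finset.range (N + 1), avoidingTerm (b + 1) c n (m + 1) i := by
  have h := Finset.sum_congr (rfl : Finset.range N = Finset.range N)
    fun i _ => avoidingTerm_succ_recurrence hcb hnm i
  rw [Finset.sum_add_distrib, Finset.sum_add_distrib] at h
  have h0 := avoidingTerm_zero_recurrence b c hnm
  simp only [Finset.sum_range_succ' _ N]
  split_ifs at h ⊢
  · linarith
  · simp only [Finset.sum_const_zero] at h
    linarith

lemma s_zero_left {p : Word} (hdz : DepthZero p) (hbf : BifixFree p) (hR : 0 < countR p)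
    (m : ℕ) : s p 0 m = 1 := by
  have hp : p ≠ [] := by
    rintro rfl
    simp [countR] at hR
  induction m with
  | zero => exact s_zero_zero hp
  | succ m ih =>
    have h := s_recurrence hdz hbf hp (n := 0) (m := (m + 1 : ℕ)) (by omega) (by omega)
    rw [s_eq_zero_of_neg p _ (by omega : (0 : ℤ) - countR p < 0),
      s_eq_zero_of_neg p _ (by omega : (0 : ℤ) - 1 < 0),
      show ((m + 1 : ℕ) : ℤ) - 1 = m by omega] at h
    omega

/-- The number of ballot paths to `(n, m)` avoiding a depth-zero, bifix-free pattern. -/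
theorem s_eq_sum_avoidingTerm {p : Word} {b c : ℕ} (hdz : DepthZero p) (hbf : BifixFree p)
    (hR : countR p = b + 1) (hU : countU p = c) (n m N : ℕ) (hnm : n ≤ m) (hN : n < N) :
    (s p n m : ℚ) = ∑ i ∈ Finset.range N, avoidingTerm (b + 1) c n m i := by
  have hcb : c ≤ b + 1 := by
    have := hdz p List.suffix_rfl
    simp only [dval, hR, hU] at this
    omega
  have hp : p ≠ [] := by
    rintro rfl
    simp [countR] at hR
  obtain ⟨t, ht⟩ : ∃ t, t = n + m := ⟨_, rfl⟩
  induction t using Nat.strong_induction_on generalizing n m N with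
  | _ t ih =>
  subst ht
  obtain ⟨N, rfl⟩ : ∃ N', N = N' + 1 := ⟨N - 1, by omega⟩
  cases n with
  | zero =>
    rw [Nat.cast_zero, s_zero_left hdz hbf (by omega), Finset.sum_range_succ',
      Finset.sum_eq_zero fun i _ => avoidingTerm_eq_zero (by positivity)]
    have : (m : ℚ) + 1 ≠ 0 := by positivity
    simp [avoidingTerm, this]
  | succ n =>
    obtain ⟨m, rfl⟩ : ∃ m', m = m' + 1 := ⟨m - 1, by omega⟩
    have hnm' : n ≤ m := by omega
    have hs := s_recurrence hdz hbf hp (n := (n + 1 : ℕ)) (m := (m + 1 : ℕ))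
      (by omega) (by omega)
    rw [show ((n + 1 : ℕ) : ℤ) - 1 = n by omega, show ((m + 1 : ℕ) : ℤ) - 1 = m by omega] at hs
    have hs' : (s p (n + 1 : ℕ) (m + 1 : ℕ) : ℚ) +
        s p ((n + 1 : ℕ) - countR p) ((m + 1 : ℕ) - countU p) =
        s p n (m + 1 : ℕ) + s p (n + 1 : ℕ) m := by exact_mod_cast hs
    have hsum := sum_avoidingTerm_recurrence hcb hnm' N
    have h1 := ih (n + (m + 1)) (by omega) n (m + 1) (N + 1) (by omega) (by omega) rfl
    have h2 : (s p (n + 1 : ℕ) m : ℚ) =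
        ∑ i ∈ Finset.range (N + 1), avoidingTerm (b + 1) c (n + 1) m i := by
      rcases hnm'.eq_or_lt with rfl | hlt
      · rw [s_eq_zero_of_lt p (by omega), Finset.sum_eq_zero fun i _ => by simp [avoidingTerm],
          Nat.cast_zero]
      · exact ih (n + 1 + m) (by omega) (n + 1) m (N + 1) (by omega) (by omega) rfl
    have h3 : (s p ((n + 1 : ℕ) - countR p) ((m + 1 : ℕ) - countU p) : ℚ) =
        if b + 1 ≤ n + 1 then
          ∑ i ∈ Finset.range N, avoidingTerm (b + 1) c (n - b) (m + 1 - c) i else 0 := by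
      rw [hR, hU]
      split_ifs with hb
      · rw [show ((n + 1 : ℕ) : ℤ) - (b + 1 : ℕ) = (n - b : ℕ) by omega,
          show ((m + 1 : ℕ) : ℤ) - c = (m + 1 - c : ℕ) by omega]
        exact ih _ (by omega) _ _ _ (by omega) (by omega) rfl
      · rw [s_eq_zero_of_neg p _ (by omega), Nat.cast_zero]
    linarith

/-- The number of Dyck paths of semilength `n` avoiding a depth-zero, bifix-free
pattern `p` of dimensions `a × c` (`a ≥ 2`, `c ≥ 1`):
`s p n n = ∑_{i ≥ 0, a i ≤ n} (-1)^i/(n-ci+1) C(n-(a-1)i, i) C(2n-(a+c-1)i, n-(a-1)i)`. -/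
theorem dyck_avoiding_bifix_free_formula (p : Word) (a c : ℕ)
    (hdz : DepthZero p) (hbf : BifixFree p)
    (hdimR : countR p = a) (hdimU : countU p = c) (ha : 2 ≤ a) (hc : 1 ≤ c)
    (n : ℕ) :
    (s p n n : ℚ) =
      ∑ i ∈ Finset.filter (fun i => a * i ≤ n) (Finset.range (n + 1)),
        (-1 : ℚ) ^ i * (1 / ((n : ℚ) - c * i + 1)) *
          (Nat.choose (n - (a - 1) * i) i : ℚ) *
          (Nat.choose (2 * n - (a + c - 1) * i) (n - (a - 1) * i) : ℚ) := by
  obtain ⟨b, rfl⟩ : ∃ b, a = b + 1 := ⟨a - 1, by omega⟩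
  rw [s_eq_sum_avoidingTerm hdz hbf hdimR hdimU n n (n + 1) le_rfl (by omega),
    Finset.sum_filter]
  refine Finset.sum_congr rfl fun i _ => ?_
  unfold avoidingTerm
  rw [two_mul, sub_self, zero_add]
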